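/- Let a : ℝ → ℝ be continuously differentiable, b : ℝ → ℝ continuous, and φ : (0,∞) → ℝ twice continuously differentiable. For every smooth function f : ℝ → ℝ with compact support contained in (0,∞) and every x > 0, one has L(Γ_φ f)(x) − Γ_φ(L f)(x) = ∫₀^∞ Φ(x,y) f(y) dy, where Φ(x,y) = (a(y) − a(x))·φ''(x+y) + (a'(y) − a'(x))·φ'(x+y) − (b(y) − b(x))·φ(x+y). -/

import Mathlib

open MeasureTheory

/-- The integrand of a Hankel operator with kernel continuous on `(0,∞)` is continuous when the
function has support in `(0,∞)`. -/
lemma continuous_hankel_integrand {ψ g : ℝ → ℝ} (hψ : ContinuousOn ψ (Set.Ioi 0))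
    (hg : Continuous g) (hgs : tsupport g ⊆ Set.Ioi 0) {x : ℝ} (hx : 0 < x) :
    Continuous fun y => ψ (x + y) * g y := by
  refine continuous_of_tsupport fun y hy => ?_
  have hy0 : 0 < y := hgs (tsupport_mul_subset_right hy)
  have h : ContinuousAt ψ (x + y) := hψ.continuousAt (Ioi_mem_nhds (add_pos hx hy0))
  exact (ContinuousAt.comp (f := fun y => x + y) h (by fun_prop)).mul hg.continuousAt

lemma integrableOn_hankel_integrand {ψ g : ℝ → ℝ} (hψ : ContinuousOn ψ (Set.Ioi 0))
    (hg : Continuous g) (hgc : HasCompactSupport g) (hgs : tsupport g ⊆ Set.Ioi 0)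
    {x : ℝ} (hx : 0 < x) :
    IntegrableOn (fun y => ψ (x + y) * g y) (Set.Ioi 0) :=
  ((continuous_hankel_integrand hψ hg hgs hx).integrable_of_hasCompactSupport
    hgc.mul_left).integrableOn

/-- Differentiation of a Hankel operator under the integral sign. -/
lemma hasDerivAt_hankel {ψ g : ℝ → ℝ} (hψ : ContDiffOn ℝ 1 ψ (Set.Ioi 0))
    (hg : Continuous g) (hgc : HasCompactSupport g) (hgs : tsupport g ⊆ Set.Ioi 0)
    {x : ℝ} (hx : 0 < x) :
    HasDerivAt (fun x => ∫ y in Set.Ioi (0 : ℝ), ψ (x + y) * g y)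
      (∫ y in Set.Ioi (0 : ℝ), deriv ψ (x + y) * g y) x := by
  have hψ' : ContinuousOn (deriv ψ) (Set.Ioi 0) :=
    hψ.continuousOn_deriv_of_isOpen isOpen_Ioi le_rfl
  obtain ⟨C, hC⟩ := (isCompact_Icc (a := x / 2) (b := 2 * x)).add hgc.isCompact
    |>.exists_bound_of_continuousOn (f := deriv ψ) (hψ'.mono (by
      rintro _ ⟨u, hu, v, hv, rfl⟩
      have hv0 : 0 < v := hgs hv
      have hu1 := hu.1
      simp only [Set.mem_Ioi]
      linarith))
  have hs : Set.Ioo (x / 2) (2 * x) ∈ nhds x := Ioo_mem_nhds (by linarith) (by linarith)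
  refine (hasDerivAt_integral_of_dominated_loc_of_deriv_le
    (F := fun x y => ψ (x + y) * g y) (F' := fun x y => deriv ψ (x + y) * g y)
    (bound := fun y => C * ‖g y‖) hs ?_
    (integrableOn_hankel_integrand hψ.continuousOn hg hgc hgs hx)
    (integrableOn_hankel_integrand hψ' hg hgc hgs hx).aestronglyMeasurable ?_ ?_ ?_).2
  · filter_upwards [Ioi_mem_nhds hx] with u hu
    exact (integrableOn_hankel_integrand hψ.continuousOn hg hgc hgs hu).aestronglyMeasurable
  · refine .of_forall fun y u hu => ?_
    by_cases hy : y ∈ tsupport g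
    · rw [norm_mul]
      gcongr
      exact hC _ (Set.add_mem_add (Set.Ioo_subset_Icc_self hu) hy)
    · simp [image_eq_zero_of_notMem_tsupport hy]
  · exact ((hg.integrable_of_hasCompactSupport hgc).norm.const_mul C).integrableOn
  · filter_upwards [ae_restrict_mem measurableSet_Ioi] with y hy u hu
    have hu0 : 0 < u := by linarith [hu.1]
    have hd : HasDerivAt ψ (deriv ψ (u + y)) (u + y) :=
      ((hψ.differentiableOn one_ne_zero).differentiableAt
        (Ioi_mem_nhds (add_pos hu0 hy))).hasDerivAt
    exact (hd.comp_add_const u y).mul_const (g y)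

/-- Integration by parts in a Hankel operator. -/
lemma integral_hankel_deriv {ψ g : ℝ → ℝ} (hψ : ContDiffOn ℝ 1 ψ (Set.Ioi 0))
    (hg : ContDiff ℝ 1 g) (hgc : HasCompactSupport g) (hgs : tsupport g ⊆ Set.Ioi 0)
    {x : ℝ} (hx : 0 < x) :
    ∫ y in Set.Ioi (0 : ℝ), ψ (x + y) * deriv g y =
      -∫ y in Set.Ioi (0 : ℝ), deriv ψ (x + y) * g y := by
  have hψ' : ContinuousOn (deriv ψ) (Set.Ioi 0) :=
    hψ.continuousOn_deriv_of_isOpen isOpen_Ioi le_rfl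
  have hi₁ := integrableOn_hankel_integrand hψ' hg.continuous hgc hgs hx
  have hi₂ := integrableOn_hankel_integrand hψ.continuousOn (hg.continuous_deriv le_rfl)
    hgc.deriv ((tsupport_deriv_subset).trans hgs) hx
  have hcont := continuous_hankel_integrand hψ.continuousOn hg.continuous hgs hx
  have hlim : Filter.Tendsto (fun y => ψ (x + y) * g y) Filter.atTop (nhds 0) :=
    (hgc.mul_left (f := fun y => ψ (x + y))).is_zero_at_infty.mono_left atTop_le_cocompact
  have key := integral_Ioi_of_hasDerivAt_of_tendsto (a := 0) hcont.continuousWithinAt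
    (f' := fun y => deriv ψ (x + y) * g y + ψ (x + y) * deriv g y)
    (fun y hy => by
      have hd : HasDerivAt ψ (deriv ψ (x + y)) (x + y) :=
        ((hψ.differentiableOn one_ne_zero).differentiableAt
          (Ioi_mem_nhds (add_pos hx hy))).hasDerivAt
      exact (hd.comp_const_add x y).mul
        ((hg.differentiable one_ne_zero) y).hasDerivAt) (hi₁.add hi₂) hlim
  have h0 : g 0 = 0 := image_eq_zero_of_notMem_tsupport fun h => lt_irrefl (0 : ℝ) (hgs h)
  rw [integral_add hi₁ hi₂, h0] at key
  linarith

/-- The commutator identity (2.4): for smooth `f` compactly supported in `(0,∞)`,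
`L(Γ_φ f)(x) - Γ_φ(L f)(x) = ∫₀^∞ Φ(x,y) f(y) dy` where
`Φ(x,y) = (a y - a x) φ''(x+y) + (a' y - a' x) φ'(x+y) - (b y - b x) φ(x+y)`. -/
theorem stmt_1 (a b φ : ℝ → ℝ)
    (ha : ContDiff ℝ 1 a) (hb : Continuous b)
    (hφ : ContDiffOn ℝ 2 φ (Set.Ioi 0))
    (f : ℝ → ℝ) (hf : ContDiff ℝ (⊤ : ℕ∞) f) (hfc : HasCompactSupport f)
    (hfs : tsupport f ⊆ Set.Ioi 0) (x : ℝ) (hx : 0 < x) :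
    (-(deriv (fun x : ℝ => a x *
          deriv (fun x : ℝ => ∫ y in Set.Ioi (0:ℝ), φ (x + y) * f y) x) x)
        + b x * ∫ y in Set.Ioi (0:ℝ), φ (x + y) * f y)
      - ∫ y in Set.Ioi (0:ℝ),
          φ (x + y) * (-(deriv (fun y : ℝ => a y * deriv f y) y) + b y * f y)
    = ∫ y in Set.Ioi (0:ℝ),
        ((a y - a x) * deriv (deriv φ) (x + y)
          + (deriv a y - deriv a x) * deriv φ (x + y)
          - (b y - b x) * φ (x + y)) * f y := by
  have hφ₁ : ContDiffOn ℝ 1 φ (Set.Ioi 0) := hφ.of_le (by norm_num)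
  have hφ' : ContDiffOn ℝ 1 (deriv φ) (Set.Ioi 0) :=
    hφ.deriv_of_isOpen isOpen_Ioi (by norm_num)
  have hφ'' : ContinuousOn (deriv (deriv φ)) (Set.Ioi 0) :=
    hφ'.continuousOn_deriv_of_isOpen isOpen_Ioi le_rfl
  have hf₁ : ContDiff ℝ 1 f := hf.of_le (by exact_mod_cast le_top)
  have hf' : ContDiff ℝ 1 (deriv f) :=
    (contDiff_infty_iff_deriv.1 hf).2.of_le (by exact_mod_cast le_top)
  have ha' : Continuous (deriv a) := ha.continuous_deriv le_rfl
  have hda : Differentiable ℝ a := ha.differentiable one_ne_zero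
  have hdf : Differentiable ℝ f := hf₁.differentiable one_ne_zero
  have integrable_mul : ∀ {ψ c g : ℝ → ℝ}, ContinuousOn ψ (Set.Ioi 0) → Continuous c →
      Continuous g → HasCompactSupport g → tsupport g ⊆ Set.Ioi 0 →
      IntegrableOn (fun y => ψ (x + y) * (c y * g y)) (Set.Ioi 0) :=
    fun hψ hc hg hgc hgs => integrableOn_hankel_integrand hψ (hc.mul hg) hgc.mul_left
      (tsupport_mul_subset_right.trans hgs) hx
  have hfs' : tsupport (deriv f) ⊆ Set.Ioi 0 := tsupport_deriv_subset.trans hfs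
  -- the derivatives of `Γ_φ f`
  have hL : deriv (fun x => a x * deriv (fun x => ∫ y in Set.Ioi (0 : ℝ), φ (x + y) * f y) x) x =
      deriv a x * (∫ y in Set.Ioi (0 : ℝ), deriv φ (x + y) * f y) +
        a x * ∫ y in Set.Ioi (0 : ℝ), deriv (deriv φ) (x + y) * f y := by
    have hloc : deriv (fun x => ∫ y in Set.Ioi (0 : ℝ), φ (x + y) * f y) =ᶠ[nhds x]
        fun x => ∫ y in Set.Ioi (0 : ℝ), deriv φ (x + y) * f y := by
      filter_upwards [Ioi_mem_nhds hx] with u hu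
      exact (hasDerivAt_hankel hφ₁ hf₁.continuous hfc hfs hu).deriv
    exact ((hda x).hasDerivAt.mul ((hasDerivAt_hankel hφ' hf₁.continuous hfc hfs
      hx).congr_of_eventuallyEq hloc)).deriv.trans (by rw [hloc.eq_of_nhds])
  -- the two integrations by parts
  have hP₁ := integral_hankel_deriv hφ₁ (ha.mul hf') hfc.deriv.mul_left
    (tsupport_mul_subset_right.trans hfs') hx
  have hP₂ := integral_hankel_deriv hφ' (ha.mul hf₁) hfc.mul_left
    (tsupport_mul_subset_right.trans hfs) hx
  have hdaf : ∀ y, deriv (fun y => a y * f y) y = deriv a y * f y + a y * deriv f y :=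
    fun y => ((hda y).hasDerivAt.mul (hdf y).hasDerivAt).deriv
  simp only [hdaf, mul_add] at hP₂
  rw [integral_add (integrable_mul hφ'.continuousOn ha' hf₁.continuous hfc hfs)
    (integrable_mul hφ'.continuousOn ha.continuous hf'.continuous hfc.deriv hfs')] at hP₂
  have hIaf' : IntegrableOn (fun y => φ (x + y) * deriv (fun y => a y * deriv f y) y)
      (Set.Ioi 0) :=
    integrableOn_hankel_integrand hφ.continuousOn ((ha.mul hf').continuous_deriv le_rfl)
      (HasCompactSupport.deriv hfc.deriv.mul_left)
      (tsupport_deriv_subset.trans (tsupport_mul_subset_right.trans hfs')) hx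
  have hIb := integrable_mul hφ.continuousOn hb hf₁.continuous hfc hfs
  have hΓL : ∫ y in Set.Ioi (0 : ℝ),
      φ (x + y) * (-(deriv (fun y : ℝ => a y * deriv f y) y) + b y * f y) =
      -(∫ y in Set.Ioi (0 : ℝ), φ (x + y) * deriv (fun y => a y * deriv f y) y) +
        ∫ y in Set.Ioi (0 : ℝ), φ (x + y) * (b y * f y) := by
    rw [← integral_neg', ← integral_add hIaf'.neg hIb]
    congr 1 with y
    simp only [Pi.neg_apply]
    ring
  have hI₀ := integrableOn_hankel_integrand hφ.continuousOn hf₁.continuous hfc hfs hx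
  have hI₁ := integrableOn_hankel_integrand hφ'.continuousOn hf₁.continuous hfc hfs hx
  have hI₂ := integrableOn_hankel_integrand hφ'' hf₁.continuous hfc hfs hx
  have hJ₁ := integrable_mul hφ'.continuousOn ha' hf₁.continuous hfc hfs
  have hJ₂ := integrable_mul hφ'' ha.continuous hf₁.continuous hfc hfs
  have hR : ∫ y in Set.Ioi (0 : ℝ), ((a y - a x) * deriv (deriv φ) (x + y)
      + (deriv a y - deriv a x) * deriv φ (x + y) - (b y - b x) * φ (x + y)) * f y =
      ((∫ y in Set.Ioi (0 : ℝ), deriv (deriv φ) (x + y) * (a y * f y)) -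
        a x * ∫ y in Set.Ioi (0 : ℝ), deriv (deriv φ) (x + y) * f y) +
      ((∫ y in Set.Ioi (0 : ℝ), deriv φ (x + y) * (deriv a y * f y)) -
        deriv a x * ∫ y in Set.Ioi (0 : ℝ), deriv φ (x + y) * f y) -
      ((∫ y in Set.Ioi (0 : ℝ), φ (x + y) * (b y * f y)) -
        b x * ∫ y in Set.Ioi (0 : ℝ), φ (x + y) * f y) := by
    have hA := hJ₂.sub (hI₂.const_mul (a x))
    have hB := hJ₁.sub (hI₁.const_mul (deriv a x))
    have hC := hIb.sub (hI₀.const_mul (b x))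
    simp only [← integral_const_mul]
    rw [← integral_sub' hJ₂ (hI₂.const_mul _), ← integral_sub' hJ₁ (hI₁.const_mul _),
      ← integral_sub' hIb (hI₀.const_mul _), ← integral_add' hA hB,
      ← integral_sub' (hA.add hB) hC]
    congr 1 with y
    simp only [Pi.add_apply, Pi.sub_apply]
    ring
  rw [hL, hΓL, hR]
  linarith
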